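/- Let 0 < p_0 < p < p_1 < ∞ satisfy 1/p = (1−θ)/p_0 + θ/p_1 for some θ ∈ (0,1). Given f ∈ C_0^∞(ℝ^n) and ε > 0, there exist finitely many smooth functions h_1^ε, …, h_{N_ε}^ε supported in cubes of ℝ^n with pairwise disjoint interiors, and nonzero complex constants c_1^ε, …, c_{N_ε}^ε, such that the functions f_z^ε = ∑_{j=1}^{N_ε} |c_j^ε|^{(p/p_0)(1−z) + (p/p_1)z} h_j^ε (for z in the closed strip 0 ≤ Re z ≤ 1) satisfy: ‖f_θ^ε − f‖_{L^2} + ‖f_θ^ε − f‖_{L^{p_0}}^{min(1,p_0)} + ‖f_θ^ε − f‖_{L^{p_1}}^{min(1,p_1)} < ε; and for all t ∈ ℝ, ‖f_{it}^ε‖_{L^{p_0}}^{p_0} ≤ ‖f‖_{L^p}^p + ε′ and ‖f_{1+it}^ε‖_{L^{p_1}}^{p_1} ≤ ‖f‖_{L^p}^p + ε′, where ε′ depends only on ε, p_0, p_1, p and ‖f‖_{L^p}, and ε′ → 0 as ε → 0. -/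

import Mathlib

open MeasureTheory Complex ENNReal
open scoped FourierTransform Real Topology NNReal

noncomputable section

abbrev Rn (n : ℕ) := EuclideanSpace ℝ (Fin n)

/-- An (axis-parallel, closed) cube in `ℝ^n`. -/
def IsCube {n : ℕ} (Q : Set (Rn n)) : Prop :=
  ∃ (c : Rn n) (l : ℝ), 0 < l ∧ Q = {x : Rn n | ∀ i, c i ≤ x i ∧ x i ≤ c i + l}

/-- The multi-index of the cell of the grid of mesh `δ` that contains `x`. -/
def gridIndex {n : ℕ} (δ : ℝ) (x : Rn n) : Fin n → ℤ := fun i => ⌊x i / δ⌋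

/-- The closed cell with multi-index `z` of the grid of mesh `δ`. -/
def gridCube {n : ℕ} (δ : ℝ) (z : Fin n → ℤ) : Set (Rn n) :=
  {x | ∀ i, z i * δ ≤ x i ∧ x i ≤ z i * δ + δ}

/-- A smooth approximation, for large `m`, of the indicator of the open cell `z`. -/
def gridBump {n : ℕ} (δ m : ℝ) (z : Fin n → ℤ) (x : Rn n) : ℝ :=
  ∏ i, (Real.smoothTransition (m * (x i - z i * δ)) *
    Real.smoothTransition (m * (z i * δ + δ - x i)))

section Grid

variable {n : ℕ} {δ m : ℝ} {z z' : Fin n → ℤ} {x : Rn n}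

lemma floor_div_eq_of_mem {a : ℝ} {k : ℤ} (hδ : 0 < δ) (h₁ : k * δ ≤ a) (h₂ : a < k * δ + δ) :
    ⌊a / δ⌋ = k := by
  rw [Int.floor_eq_iff, le_div_iff₀ hδ, div_lt_iff₀ hδ]
  constructor <;> linarith

lemma mem_gridCube_gridIndex (hδ : 0 < δ) (x : Rn n) : x ∈ gridCube δ (gridIndex δ x) := by
  intro i
  have h₁ := Int.floor_le (x i / δ)
  have h₂ := (Int.lt_floor_add_one (x i / δ)).le
  rw [le_div_iff₀ hδ] at h₁
  rw [div_le_iff₀ hδ] at h₂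
  simp only [gridIndex]
  constructor <;> linarith

lemma isCube_gridCube (hδ : 0 < δ) (z : Fin n → ℤ) : IsCube (gridCube δ z) :=
  ⟨WithLp.toLp 2 fun i => z i * δ, δ, hδ, rfl⟩

lemma isCompact_gridCube (δ : ℝ) (z : Fin n → ℤ) : IsCompact (gridCube δ z) := by
  have h : gridCube δ z = (EuclideanSpace.equiv (Fin n) ℝ).toHomeomorph ⁻¹'
      Set.univ.pi fun i => Set.Icc (z i * δ) (z i * δ + δ) := by
    ext x
    simp only [gridCube, Set.mem_ofPred_eq, Set.mem_preimage, Set.mem_pi, Set.mem_univ, true_imp_iff]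
    rfl
  rw [h, Homeomorph.isCompact_preimage]
  exact isCompact_univ_pi fun _ => isCompact_Icc

lemma corner_mem_gridCube (hδ : 0 < δ) (z : Fin n → ℤ) :
    WithLp.toLp 2 (fun i => z i * δ) ∈ gridCube δ z :=
  fun i => ⟨le_rfl, by simp [hδ.le]⟩

lemma isOpenMap_coord (i : Fin n) : IsOpenMap fun x : Rn n => x i :=
  (isOpenMap_eval i).comp (EuclideanSpace.equiv (Fin n) ℝ).toHomeomorph.isOpenMap

lemma interior_gridCube_inter (hδ : 0 < δ) (h : z ≠ z') :
    interior (gridCube δ z) ∩ interior (gridCube δ z') = ∅ := by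
  have key : ∀ (w : Fin n → ℤ) (x : Rn n), x ∈ interior (gridCube δ w) →
      ∀ i, ⌊x i / δ⌋ = w i := by
    intro w x hx i
    have h₁ : gridCube δ w ⊆ (fun x : Rn n => x i) ⁻¹' Set.Icc (w i * δ) (w i * δ + δ) :=
      fun y hy => hy i
    have h₂ := (isOpenMap_coord i).interior_preimage_subset_preimage_interior (interior_mono h₁ hx)
    rw [interior_Icc] at h₂
    exact floor_div_eq_of_mem hδ h₂.1.le h₂.2
  refine Set.eq_empty_of_forall_notMem fun x hx => h ?_
  funext i
  rw [← key z x hx.1 i, ← key z' x hx.2 i]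

lemma gridBump_nonneg : 0 ≤ gridBump δ m z x :=
  Finset.prod_nonneg fun _ _ =>
    mul_nonneg (Real.smoothTransition.nonneg _) (Real.smoothTransition.nonneg _)

lemma gridBump_le_one : gridBump δ m z x ≤ 1 :=
  Finset.prod_le_one
    (fun _ _ => mul_nonneg (Real.smoothTransition.nonneg _) (Real.smoothTransition.nonneg _))
    fun _ _ => mul_le_one₀ (Real.smoothTransition.le_one _) (Real.smoothTransition.nonneg _)
      (Real.smoothTransition.le_one _)

lemma lt_of_gridBump_ne_zero (hm : 0 < m) (h : gridBump δ m z x ≠ 0) (i : Fin n) :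
    z i * δ < x i ∧ x i < z i * δ + δ := by
  have h₁ := Finset.prod_ne_zero_iff.1 h i (Finset.mem_univ i)
  have h₂ : ∀ a : ℝ, Real.smoothTransition (m * a) ≠ 0 → 0 < a := by
    intro a ha
    by_contra! hle
    exact ha (Real.smoothTransition.zero_of_nonpos (mul_nonpos_of_nonneg_of_nonpos hm.le hle))
  have h₃ := h₂ _ (left_ne_zero_of_mul h₁)
  have h₄ := h₂ _ (right_ne_zero_of_mul h₁)
  constructor <;> linarith

lemma support_gridBump_subset (hm : 0 < m) : Function.support (gridBump δ m z) ⊆ gridCube δ z :=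
  fun _ hx i => (lt_of_gridBump_ne_zero hm hx i).imp le_of_lt le_of_lt

lemma gridBump_eq_zero_of_ne (hδ : 0 < δ) (hm : 0 < m) (h : z ≠ gridIndex δ x) :
    gridBump δ m z x = 0 := by
  by_contra hne
  refine h (funext fun i => ?_)
  have hi := lt_of_gridBump_ne_zero hm hne i
  exact (floor_div_eq_of_mem hδ hi.1.le hi.2).symm

lemma contDiff_gridBump : ContDiff ℝ (⊤ : ℕ∞) (gridBump δ m z) := by
  refine contDiff_prod fun i _ => ContDiff.mul ?_ ?_ <;>
  · refine Real.smoothTransition.contDiff.comp ?_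
    fun_prop

/-- On the open cell the bumps are eventually equal to one. -/
lemma tendsto_gridBump (h : ∀ i, z i * δ < x i ∧ x i < z i * δ + δ) :
    Filter.Tendsto (fun k : ℕ => gridBump δ (k + 1) z x) Filter.atTop (𝓝 1) := by
  have h₁ : ∀ a : ℝ, 0 < a → Filter.Tendsto
      (fun k : ℕ => Real.smoothTransition (((k : ℝ) + 1) * a)) Filter.atTop (𝓝 1) := by
    intro a ha
    have h₂ : Filter.Tendsto (fun k : ℕ => ((k : ℝ) + 1) * a) Filter.atTop Filter.atTop :=
      (Filter.tendsto_atTop_add_const_right _ 1 tendsto_natCast_atTop_atTop).atTop_mul_const ha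
    refine tendsto_const_nhds.congr' ?_
    filter_upwards [h₂.eventually_ge_atTop 1] with k hk
    exact (Real.smoothTransition.one_of_one_le hk).symm
  have h₃ : Filter.Tendsto (fun k : ℕ => gridBump δ (k + 1) z x) Filter.atTop
      (𝓝 (∏ _i : Fin n, (1 * 1 : ℝ))) :=
    tendsto_finsetProd _ fun i _ =>
      (h₁ _ (sub_pos.2 (h i).1)).mul (h₁ _ (sub_pos.2 (h i).2))
  simpa using h₃

/-- Almost every point lies in the interior of its cell. -/
lemma ae_lt_gridIndex (hδ : 0 < δ) : ∀ᵐ x : Rn n,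
    ∀ i, gridIndex δ x i * δ < x i ∧ x i < gridIndex δ x i * δ + δ := by
  rw [ae_all_iff]
  intro i
  have hq : Measure.QuasiMeasurePreserving (fun x : Rn n => x i) volume volume :=
    (Measure.quasiMeasurePreserving_eval (fun _ : Fin n => (volume : Measure ℝ)) i).comp
      (EuclideanSpace.volume_preserving_symm_measurableEquiv_toLp (Fin n)).quasiMeasurePreserving
  have hc : ∀ᵐ a : ℝ, a ∉ Set.range fun k : ℤ => (k : ℝ) * δ :=
    (Set.countable_range _).ae_notMem _
  filter_upwards [hq.ae hc] with x hx
  have h₁ := mem_gridCube_gridIndex hδ x i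
  refine ⟨lt_of_le_of_ne h₁.1 fun h => hx ⟨_, h⟩, lt_of_le_of_ne h₁.2 fun h => hx ?_⟩
  exact ⟨gridIndex δ x i + 1, by rw [h]; push_cast; ring⟩

/-- Points sharing grid cells of mesh tending to zero with `x` converge to `x`. -/
lemma tendsto_of_mem_gridCube {y : ℕ → Rn n} {d : ℕ → ℝ}
    (hd : ∀ k, 0 < d k) (hd₀ : Filter.Tendsto d Filter.atTop (𝓝 0))
    (hy : ∀ k, y k ∈ gridCube (d k) (gridIndex (d k) x)) :
    Filter.Tendsto y Filter.atTop (𝓝 x) := by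
  rw [(EuclideanSpace.equiv (Fin n) ℝ).toHomeomorph.isInducing.tendsto_nhds_iff, tendsto_pi_nhds]
  intro i
  rw [tendsto_iff_dist_tendsto_zero]
  refine squeeze_zero (fun _ => dist_nonneg) (fun k => ?_) hd₀
  have h₁ := hy k i
  have h₂ := mem_gridCube_gridIndex (hd k) x i
  change |y k i - x i| ≤ d k
  rw [abs_le]
  constructor <;> linarith [h₁.1, h₁.2, h₂.1, h₂.2]

/-- Only finitely many cells are contained in a bounded set. -/
lemma finite_gridCube_subset (hδ : 0 < δ) {s : Set (Rn n)} (hs : Bornology.IsBounded s) :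
    {z : Fin n → ℤ | gridCube δ z ⊆ s}.Finite := by
  obtain ⟨R, hR⟩ := hs.subset_closedBall 0
  refine (Set.finite_Icc (fun _ : Fin n => -⌈R / δ⌉) fun _ => ⌈R / δ⌉).subset fun z hz => ?_
  have h₁ := hR (hz (corner_mem_gridCube hδ z))
  rw [mem_closedBall_zero_iff] at h₁
  have h₂ : ∀ i, |(z i : ℝ)| ≤ ⌈R / δ⌉ := by
    intro i
    have h₃ := (PiLp.norm_apply_le (WithLp.toLp 2 fun i => (z i : ℝ) * δ) i).trans h₁
    rw [PiLp.toLp_apply, Real.norm_eq_abs, abs_mul, abs_of_pos hδ, ← le_div_iff₀ hδ] at h₃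
    exact h₃.trans (Int.le_ceil _)
  refine ⟨fun i => ?_, fun i => ?_⟩
  · have := (abs_le.1 (h₂ i)).1
    exact_mod_cast this
  · have := (abs_le.1 (h₂ i)).2
    exact_mod_cast this

end Grid

/-- A choice of value of `f` of least modulus on each cell. -/
lemma exists_gridMin {n : ℕ} {f : Rn n → ℂ} (hf : Continuous f) {δ : ℝ} (hδ : 0 < δ)
    (z : Fin n → ℤ) : ∃ y ∈ gridCube δ z, ∀ x ∈ gridCube δ z, ‖f y‖ ≤ ‖f x‖ := by
  obtain ⟨y, hy, hmin⟩ := (isCompact_gridCube δ z).exists_isMinOn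
    ⟨_, corner_mem_gridCube hδ z⟩ hf.norm.continuousOn
  exact ⟨y, hy, fun x hx => hmin hx⟩

lemma tendsto_eLpNorm_sub {α : Type*} [MeasurableSpace α] {μ : Measure α} {f G : α → ℂ}
    {F : ℕ → α → ℂ} {q : ℝ} (hq : 0 < q) (hf : MemLp f (ENNReal.ofReal q) μ)
    (hF : ∀ k, AEStronglyMeasurable (F k) μ) (hle : ∀ k x, ‖F k x‖ ≤ ‖f x‖)
    (hlim : ∀ᵐ x ∂μ, Filter.Tendsto (fun k => F k x) Filter.atTop (𝓝 (G x))) :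
    Filter.Tendsto (fun k => eLpNorm (fun x => F k x - f x) (ENNReal.ofReal q) μ) Filter.atTop
      (𝓝 (eLpNorm (fun x => G x - f x) (ENNReal.ofReal q) μ)) := by
  have hq₀ : ENNReal.ofReal q ≠ 0 := by simpa using hq
  simp only [eLpNorm_eq_lintegral_rpow_enorm_toReal hq₀ ofReal_ne_top, toReal_ofReal hq.le]
  refine (ENNReal.continuous_rpow_const.tendsto _).comp ?_
  refine tendsto_lintegral_of_dominated_convergence' (fun x => (2 * ‖f x‖ₑ) ^ q)
    (fun k => ((hF k).sub hf.1).enorm.pow_const q) (fun k => ?_) ?_ ?_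
  · refine Filter.Eventually.of_forall fun x => ?_
    dsimp only
    gcongr
    refine (enorm_sub_le).trans ?_
    rw [two_mul]
    gcongr
    exact enorm_le_iff_norm_le.2 (hle k x)
  · simp_rw [ENNReal.mul_rpow_of_nonneg _ _ hq.le]
    rw [lintegral_const_mul' _ _ (by finiteness)]
    have h := lintegral_rpow_enorm_lt_top_of_eLpNorm_lt_top hq₀ ofReal_ne_top hf.2
    rw [toReal_ofReal hq.le] at h
    exact ENNReal.mul_ne_top (by finiteness) h.ne
  · filter_upwards [hlim] with x hx
    exact (ENNReal.continuous_rpow_const.tendsto _).comp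
      ((continuous_enorm.tendsto _).comp (hx.sub_const _))

lemma eLpNorm_rpow_le_of_norm_le {α : Type*} [MeasurableSpace α] {μ : Measure α} {f g : α → ℂ}
    {p q : ℝ} (hp : 0 < p) (hq : 0 < q) (h : ∀ x, ‖g x‖ ≤ ‖f x‖ ^ (p / q)) :
    eLpNorm g (ENNReal.ofReal q) μ ^ q ≤ eLpNorm f (ENNReal.ofReal p) μ ^ p := by
  have hpow : ∀ (u : α → ℂ) {r : ℝ}, 0 < r →
      eLpNorm u (ENNReal.ofReal r) μ ^ r = ∫⁻ x, ‖u x‖ₑ ^ r ∂μ := by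
    intro u r hr
    rw [eLpNorm_eq_lintegral_rpow_enorm_toReal (by simpa using hr) ofReal_ne_top,
      toReal_ofReal hr.le, ← ENNReal.rpow_mul, one_div_mul_cancel hr.ne', ENNReal.rpow_one]
  rw [hpow g hq, hpow f hp]
  refine lintegral_mono fun x => ?_
  have h₁ : ‖g x‖ₑ ≤ ‖f x‖ₑ ^ (p / q) := by
    rw [← ofReal_norm, ← ofReal_norm, ENNReal.ofReal_rpow_of_nonneg (norm_nonneg _) (by positivity)]
    exact ENNReal.ofReal_le_ofReal (h x)
  calc ‖g x‖ₑ ^ q ≤ (‖f x‖ₑ ^ (p / q)) ^ q := by gcongr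
    _ = ‖f x‖ₑ ^ p := by rw [← ENNReal.rpow_mul, div_mul_cancel₀ _ hq.ne']

/-- At each point at most one bump contributes to a combination of bumps. -/
lemma sum_mul_gridBump {n : ℕ} {δ m : ℝ} (hδ : 0 < δ) (hm : 0 < m) (J : Finset (Fin n → ℤ))
    (a : (Fin n → ℤ) → ℂ) (x : Rn n) :
    ∑ z ∈ J, a z * (gridBump δ m z x : ℂ) =
      if gridIndex δ x ∈ J then a (gridIndex δ x) * (gridBump δ m (gridIndex δ x) x : ℂ)
      else 0 := by
  split_ifs with h
  · refine Finset.sum_eq_single_of_mem _ h fun z _ hz => ?_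
    rw [gridBump_eq_zero_of_ne hδ hm hz, Complex.ofReal_zero, mul_zero]
  · refine Finset.sum_eq_zero fun z hz => ?_
    rw [gridBump_eq_zero_of_ne hδ hm fun h' => h (h' ▸ hz), Complex.ofReal_zero, mul_zero]

lemma norm_gridBump_le_one {n : ℕ} {δ m : ℝ} {z : Fin n → ℤ} {x : Rn n} :
    ‖(gridBump δ m z x : ℂ)‖ ≤ 1 := by
  rw [norm_real, Real.norm_of_nonneg gridBump_nonneg]
  exact gridBump_le_one

/-- A continuous compactly supported function is approximated in finitely many Lebesgue norms by
combinations of bumps whose coefficients have modulus at most the minimum of `‖f‖` on the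
corresponding cell. -/
lemma exists_gridBump_approx {n : ℕ} {f : Rn n → ℂ} (hf : Continuous f)
    (hfc : HasCompactSupport f) {p₀ p₁ r₀ r₁ ε : ℝ} (hp₀ : 0 < p₀) (hp₁ : 0 < p₁)
    (hr₀ : 0 < r₀) (hr₁ : 0 < r₁) (hε : 0 < ε) :
    ∃ (δ m : ℝ) (J : Finset (Fin n → ℤ)) (c : (Fin n → ℤ) → ℂ), 0 < δ ∧ 0 < m ∧
      (∀ z, z ∈ J ↔ c z ≠ 0) ∧ (∀ z, ∀ x ∈ gridCube δ z, ‖c z‖ ≤ ‖f x‖) ∧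
      eLpNorm (fun x => ∑ z ∈ J, c z * (gridBump δ m z x : ℂ) - f x) 2 volume
        + eLpNorm (fun x => ∑ z ∈ J, c z * (gridBump δ m z x : ℂ) - f x)
            (ENNReal.ofReal p₀) volume ^ r₀
        + eLpNorm (fun x => ∑ z ∈ J, c z * (gridBump δ m z x : ℂ) - f x)
            (ENNReal.ofReal p₁) volume ^ r₁ < ENNReal.ofReal ε := by
  set Φ : (Rn n → ℂ) → ℝ≥0∞ := fun F =>
    eLpNorm (fun x => F x - f x) 2 volume
      + eLpNorm (fun x => F x - f x) (ENNReal.ofReal p₀) volume ^ r₀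
      + eLpNorm (fun x => F x - f x) (ENNReal.ofReal p₁) volume ^ r₁ with hΦ
  have hΦ_lim : ∀ (F : ℕ → Rn n → ℂ) (G : Rn n → ℂ), (∀ k, AEStronglyMeasurable (F k) volume) →
      (∀ k x, ‖F k x‖ ≤ ‖f x‖) →
      (∀ᵐ x, Filter.Tendsto (fun k => F k x) Filter.atTop (𝓝 (G x))) →
      Filter.Tendsto (fun k => Φ (F k)) Filter.atTop (𝓝 (Φ G)) := by
    intro F G hF hle hlim
    have hq : ∀ q : ℝ, 0 < q → _ := fun q hq =>
      tendsto_eLpNorm_sub hq (hf.memLp_of_hasCompactSupport hfc) hF hle hlim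
    have h2 := hq 2 two_pos
    rw [ENNReal.ofReal_ofNat] at h2
    exact (h2.add ((ENNReal.continuous_rpow_const.tendsto _).comp (hq p₀ hp₀))).add
      ((ENNReal.continuous_rpow_const.tendsto _).comp (hq p₁ hp₁))
  have hΦf : Φ f = 0 := by simp [hΦ, hr₀, hr₁]
  set d : ℕ → ℝ := fun k => 1 / ((k : ℝ) + 1)
  have hd : ∀ k, 0 < d k := fun k => by positivity
  choose y hy hmin using fun k => exists_gridMin hf (hd k)
  set S : ℕ → Rn n → ℂ := fun k x => f (y k (gridIndex (d k) x))
  set F : ℕ → ℕ → Rn n → ℂ := fun k l x =>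
    f (y k (gridIndex (d k) x)) * (gridBump (d k) (l + 1) (gridIndex (d k) x) x : ℂ)
  have hJ : ∀ k, {z | f (y k z) ≠ 0}.Finite := fun k =>
    (finite_gridCube_subset (hd k) hfc.isCompact.isBounded).subset fun z hz x hx =>
      subset_tsupport f fun h0 => hz (norm_le_zero_iff.1 ((hmin k z x hx).trans (by simp [h0])))
  have hF : ∀ k l x,
      F k l x = ∑ z ∈ (hJ k).toFinset, f (y k z) * (gridBump (d k) (l + 1) z x : ℂ) := by
    intro k l x
    rw [sum_mul_gridBump (hd k) (by positivity)]
    split_ifs with h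
    · rfl
    · have h0 : f (y k (gridIndex (d k) x)) = 0 := by simpa using h
      simp [F, h0]
  have hFm : ∀ k l, AEStronglyMeasurable (F k l) volume := by
    intro k l
    have h : Continuous (F k l) := by
      rw [funext (hF k l)]
      exact continuous_finsetSum _ fun z _ => continuous_const.mul
        (Complex.continuous_ofReal.comp contDiff_gridBump.continuous)
    exact h.aestronglyMeasurable
  have hSle : ∀ k x, ‖S k x‖ ≤ ‖f x‖ := fun k x =>
    hmin k _ x (mem_gridCube_gridIndex (hd k) x)
  have hFle : ∀ k l x, ‖F k l x‖ ≤ ‖f x‖ := fun k l x => by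
    rw [norm_mul]
    exact (mul_le_of_le_one_right (norm_nonneg _) norm_gridBump_le_one).trans (hSle k x)
  have hFS : ∀ k, ∀ᵐ x, Filter.Tendsto (fun l => F k l x) Filter.atTop (𝓝 (S k x)) := by
    intro k
    filter_upwards [ae_lt_gridIndex (hd k)] with x hx
    have h := ((Complex.continuous_ofReal.tendsto _).comp (tendsto_gridBump hx)).const_mul (S k x)
    rwa [Complex.ofReal_one, mul_one] at h
  have hSm : ∀ k, AEStronglyMeasurable (S k) volume := fun k =>
    aestronglyMeasurable_of_tendsto_ae Filter.atTop (hFm k) (hFS k)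
  have hSf : ∀ x, Filter.Tendsto (fun k => S k x) Filter.atTop (𝓝 (f x)) := fun x =>
    (hf.tendsto x).comp
      (tendsto_of_mem_gridCube hd tendsto_one_div_add_atTop_nhds_zero_nat fun k => hy k _)
  have hε' : Φ f < ENNReal.ofReal ε := by simpa [hΦf] using hε
  obtain ⟨k, hk⟩ :=
    ((hΦ_lim S f hSm hSle (Filter.Eventually.of_forall hSf)).eventually_lt_const hε').exists
  obtain ⟨l, hl⟩ := ((hΦ_lim (F k) (S k) (hFm k) (hFle k) (hFS k)).eventually_lt_const hk).exists
  refine ⟨d k, l + 1, (hJ k).toFinset, fun z => f (y k z), hd k, by positivity, fun z => by simp,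
    hmin k, ?_⟩
  rw [funext (hF k l)] at hl
  exact hl

/-- **Lemma 2.1**: approximation of a smooth compactly supported function `f` by simple-type
functions `f_z^ε` built from smooth bumps supported in cubes with pairwise disjoint interiors,
with quantitative control of `‖f_{it}^ε‖_{L^{p_0}}` and `‖f_{1+it}^ε‖_{L^{p_1}}` by
`‖f‖_{L^p}^p + ε′`, where `ε′ = ε′(ε, p_0, p_1, p, ‖f‖_{L^p}) → 0` as `ε → 0`. -/
theorem approximation_for_interpolation
    {n : ℕ} (p₀ p p₁ θ : ℝ) (hp₀ : 0 < p₀) (hp₀p : p₀ < p) (hpp₁ : p < p₁)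
    (hθ : θ ∈ Set.Ioo (0 : ℝ) 1) (hp : 1 / p = (1 - θ) / p₀ + θ / p₁)
    (f : Rn n → ℂ) (hf : ContDiff ℝ (⊤ : ℕ∞) f) (hfc : HasCompactSupport f) :
    ∃ E : ℝ → ℝ, Filter.Tendsto E (𝓝[>] (0 : ℝ)) (𝓝 0) ∧
      ∀ ε : ℝ, 0 < ε →
        ∃ (N : ℕ) (h : Fin N → Rn n → ℂ) (Q : Fin N → Set (Rn n)) (c : Fin N → ℂ),
          (∀ j, ContDiff ℝ (⊤ : ℕ∞) (h j)) ∧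
          (∀ j, IsCube (Q j)) ∧
          (∀ j, Function.support (h j) ⊆ Q j) ∧
          (∀ j k, j ≠ k → interior (Q j) ∩ interior (Q k) = ∅) ∧
          (∀ j, c j ≠ 0) ∧
          (eLpNorm (fun x =>
              (∑ j, ((‖c j‖ : ℂ) ^ ((p / p₀ : ℂ) * (1 - (θ : ℂ)) + (p / p₁ : ℂ) * (θ : ℂ)))
                  * h j x) - f x) 2 volume
            + eLpNorm (fun x =>
              (∑ j, ((‖c j‖ : ℂ) ^ ((p / p₀ : ℂ) * (1 - (θ : ℂ)) + (p / p₁ : ℂ) * (θ : ℂ)))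
                  * h j x) - f x) (ENNReal.ofReal p₀) volume ^ (min 1 p₀)
            + eLpNorm (fun x =>
              (∑ j, ((‖c j‖ : ℂ) ^ ((p / p₀ : ℂ) * (1 - (θ : ℂ)) + (p / p₁ : ℂ) * (θ : ℂ)))
                  * h j x) - f x) (ENNReal.ofReal p₁) volume ^ (min 1 p₁)
            < ENNReal.ofReal ε) ∧
          (∀ t : ℝ,
            eLpNorm (fun x =>
                ∑ j, ((‖c j‖ : ℂ) ^ ((p / p₀ : ℂ) * (1 - (t : ℂ) * Complex.I)
                    + (p / p₁ : ℂ) * ((t : ℂ) * Complex.I))) * h j x)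
              (ENNReal.ofReal p₀) volume ^ p₀
              ≤ eLpNorm f (ENNReal.ofReal p) volume ^ p + ENNReal.ofReal (E ε)) ∧
          (∀ t : ℝ,
            eLpNorm (fun x =>
                ∑ j, ((‖c j‖ : ℂ) ^ ((p / p₀ : ℂ) * (1 - (1 + (t : ℂ) * Complex.I))
                    + (p / p₁ : ℂ) * (1 + (t : ℂ) * Complex.I))) * h j x)
              (ENNReal.ofReal p₁) volume ^ p₁
              ≤ eLpNorm f (ENNReal.ofReal p) volume ^ p + ENNReal.ofReal (E ε)) := by
  have hp' : 0 < p := hp₀.trans hp₀p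
  have hp₁ : 0 < p₁ := hp'.trans hpp₁
  refine ⟨fun _ => 0, tendsto_const_nhds, fun ε hε => ?_⟩
  obtain ⟨δ, m, J, c, hδ, hm, hJ, hc, happrox⟩ := exists_gridBump_approx hf.continuous hfc hp₀ hp₁
    (lt_min one_pos hp₀) (lt_min one_pos hp₁) hε
  set e : Fin J.card → Fin n → ℤ := fun j => J.equivFin.symm j
  have he : Function.Injective e := Subtype.val_injective.comp J.equivFin.symm.injective
  have hce : ∀ j, c (e j) ≠ 0 := fun j => (hJ _).1 (J.equivFin.symm j).2
  have hsum : ∀ G : (Fin n → ℤ) → ℂ, ∑ j, G (e j) = ∑ z ∈ J, G z := fun G => by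
    rw [← Finset.sum_coe_sort J G]
    exact Equiv.sum_comp J.equivFin.symm fun z : J => G z
  have hθ_exp : (p / p₀ : ℂ) * (1 - (θ : ℂ)) + (p / p₁ : ℂ) * (θ : ℂ) = 1 := by
    have h : p / p₀ * (1 - θ) + p / p₁ * θ = 1 := by
      calc p / p₀ * (1 - θ) + p / p₁ * θ = p * ((1 - θ) / p₀ + θ / p₁) := by ring
        _ = 1 := by rw [← hp, mul_one_div_cancel hp'.ne']
    exact_mod_cast h
  have hFθ : ∀ x, ∑ j, (‖c (e j)‖ : ℂ) ^ ((p / p₀ : ℂ) * (1 - (θ : ℂ)) + (p / p₁ : ℂ) * (θ : ℂ))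
      * (c (e j) / ‖c (e j)‖ * (gridBump δ m (e j) x : ℂ))
      = ∑ z ∈ J, c z * (gridBump δ m z x : ℂ) := by
    intro x
    rw [← hsum fun z => c z * (gridBump δ m z x : ℂ)]
    refine Finset.sum_congr rfl fun j _ => ?_
    have h : (‖c (e j)‖ : ℂ) ≠ 0 := by simpa using hce j
    rw [hθ_exp, cpow_one, ← mul_assoc, mul_div_cancel₀ _ h]
  have hbound : ∀ (w : ℂ) (r : ℝ), 0 < r → w.re = r → ∀ x,
      ‖∑ j, (‖c (e j)‖ : ℂ) ^ w * (c (e j) / ‖c (e j)‖ * (gridBump δ m (e j) x : ℂ))‖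
        ≤ ‖f x‖ ^ r := by
    intro w r hr hw x
    rw [hsum fun z => (‖c z‖ : ℂ) ^ w * (c z / ‖c z‖ * (gridBump δ m z x : ℂ))]
    simp_rw [← mul_assoc]
    rw [sum_mul_gridBump hδ hm]
    split_ifs with h
    · have h₀ : 0 < ‖c (gridIndex δ x)‖ := norm_pos_iff.2 ((hJ _).1 h)
      rw [norm_mul, norm_mul, norm_cpow_eq_rpow_re_of_pos h₀, norm_div, norm_real, norm_norm,
        div_self h₀.ne', mul_one, hw]
      exact (mul_le_of_le_one_right (by positivity) norm_gridBump_le_one).trans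
        (Real.rpow_le_rpow h₀.le (hc _ x (mem_gridCube_gridIndex hδ x)) hr.le)
    · rw [norm_zero]
      positivity
  refine ⟨J.card, fun j x => c (e j) / ‖c (e j)‖ * (gridBump δ m (e j) x : ℂ),
    fun j => gridCube δ (e j), fun j => c (e j), fun j => ?_, fun j => isCube_gridCube hδ _,
    fun j => ?_, fun j k hjk => interior_gridCube_inter hδ (he.ne hjk), hce, ?_,
    fun t => ?_, fun t => ?_⟩
  · exact contDiff_const.mul (ofRealCLM.contDiff.comp contDiff_gridBump)
  · refine fun x hx => support_gridBump_subset hm fun h => hx ?_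
    simp only [h, Complex.ofReal_zero, mul_zero]
  · simp only [hFθ]
    exact happrox
  · rw [ENNReal.ofReal_zero, add_zero]
    refine eLpNorm_rpow_le_of_norm_le hp' hp₀ (hbound _ _ (by positivity) ?_)
    have h : (p / p₀ : ℂ) * (1 - (t : ℂ) * I) + (p / p₁ : ℂ) * ((t : ℂ) * I)
        = ((p / p₀ : ℝ) : ℂ) + ((t * (p / p₁ - p / p₀) : ℝ) : ℂ) * I := by
      push_cast
      ring
    rw [h, add_re, ofReal_re, re_ofReal_mul, I_re, mul_zero, add_zero]
  · rw [ENNReal.ofReal_zero, add_zero]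
    refine eLpNorm_rpow_le_of_norm_le hp' hp₁ (hbound _ _ (by positivity) ?_)
    have h : (p / p₀ : ℂ) * (1 - (1 + (t : ℂ) * I)) + (p / p₁ : ℂ) * (1 + (t : ℂ) * I)
        = ((p / p₁ : ℝ) : ℂ) + ((t * (p / p₁ - p / p₀) : ℝ) : ℂ) * I := by
      push_cast
      ring
    rw [h, add_re, ofReal_re, re_ofReal_mul, I_re, mul_zero, add_zero]
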